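/- arXiv:1407.5287 — 4 statements merged into one kernel-verified Lean document; each statement's English description precedes it below -/
import Mathlib

section
/- (Second-order fractional trapezoidal quadrature for power functions.) Let β > 0 and ν ≥ 0 be real numbers. Let α_k = (−1)^k binom(β,k), θ_k = 2^{−β} binom(β,k), and let (ω_k^{(β)})_{k≥0} be the real sequence determined by ∑_{j=0}^{k} α_j ω_{k−j}^{(β)} = θ_k for all k ≥ 0 (the Taylor coefficients of the generating function ((1+z)/(2(1−z)))^β). Then there exists a constant C > 0, depending only on β and ν, such that for every τ > 0 and every integer n ≥ 1, with t_n = nτ, | Γ(ν+1)/Γ(ν+β+1) · t_n^{ν+β} − τ^{β} ∑_{k=0}^{n} ω_{n−k}^{(β)} (kτ)^{ν} | ≤ C ( t_n^{ν+β−2} τ² + t_n^{β−1} τ^{ν+1} ). -/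
/-- The generalized binomial coefficient `binom(β,k) = β(β−1)⋯(β−k+1)/k!`. -/
noncomputable def gbinom (β : ℝ) (k : ℕ) : ℝ :=
  (∏ i ∈ Finset.range k, (β - i)) / (Nat.factorial k)

open Filter Topology Finset

section

open PowerSeries

theorem choose_succ_mul (r : ℝ) (n : ℕ) :
    (n + 1 : ℝ) * Ring.choose r (n + 1) = (r - n) * Ring.choose r n := by
  have h := Ring.choose_smul_choose r (Nat.le_succ n)
  simpa [Ring.choose_one_right, mul_comm] using h

theorem gbinom_eq_choose (r : ℝ) (n : ℕ) : gbinom r n = Ring.choose r n := by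
  induction n with
  | zero => simp [gbinom]
  | succ n ih =>
    have h := choose_succ_mul r n
    rw [← ih] at h
    have h1 : (n + 1 : ℝ) ≠ 0 := by positivity
    have h2 : (n.factorial : ℝ) ≠ 0 := by positivity
    apply mul_left_cancel₀ h1
    rw [h]
    simp only [gbinom, Finset.prod_range_succ, Nat.factorial_succ]
    push_cast
    field_simp

/-- The formal power series `(1 - X) ^ (-μ)`. -/
noncomputable def negBinomialSeries (μ : ℝ) : PowerSeries ℝ :=
  rescale (-1) (PowerSeries.binomialSeries ℝ (-μ))

/-- The formal power series `((1 + X) / (2 (1 - X))) ^ μ`. -/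
noncomputable def trapSeries (μ : ℝ) : PowerSeries ℝ :=
  C ((2 : ℝ) ^ (-μ)) * (negBinomialSeries μ * PowerSeries.binomialSeries ℝ μ)

theorem trapSeries_add (a b : ℝ) : trapSeries (a + b) = trapSeries a * trapSeries b := by
  have h : (2 : ℝ) ^ (-(a + b)) = 2 ^ (-a) * 2 ^ (-b) := by
    rw [← Real.rpow_add two_pos, neg_add]
  simp only [trapSeries, negBinomialSeries, neg_add, binomialSeries_add, map_mul] at h ⊢
  rw [h, map_mul]
  ring

theorem eq_coeff_trapSeries {β : ℝ} {ω : ℕ → ℝ}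
    (hω : ∀ k : ℕ, ∑ j ∈ Finset.range (k + 1), (-1 : ℝ) ^ j * gbinom β j * ω (k - j) =
      2 ^ (-β) * gbinom β k) (n : ℕ) : ω n = coeff n (trapSeries β) := by
  have key : rescale (-1) (PowerSeries.binomialSeries ℝ β) * PowerSeries.mk ω =
      C ((2 : ℝ) ^ (-β)) * PowerSeries.binomialSeries ℝ β := by
    ext k
    rw [coeff_mul, Finset.Nat.sum_antidiagonal_eq_sum_range_succ_mk, coeff_C_mul]
    simpa [coeff_rescale, gbinom_eq_choose] using hω k
  have inv : negBinomialSeries β * rescale (-1) (PowerSeries.binomialSeries ℝ β) = 1 := by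
    rw [negBinomialSeries, ← map_mul, ← binomialSeries_add]
    simp
  have : PowerSeries.mk ω = trapSeries β := by
    calc PowerSeries.mk ω
        = negBinomialSeries β * rescale (-1) (PowerSeries.binomialSeries ℝ β) * PowerSeries.mk ω := by
          rw [inv, one_mul]
      _ = trapSeries β := by rw [mul_assoc, key, trapSeries]; ring
  rw [← this, coeff_mk]

theorem derivative_binomialSeries (r : ℝ) :
    (1 + X) * d⁄dX ℝ (PowerSeries.binomialSeries ℝ r) = r • PowerSeries.binomialSeries ℝ r := by
  ext n
  cases n with
  | zero =>
    simp only [add_mul, one_mul, map_add, coeff_derivative, coeff_zero_X_mul, coeff_smul]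
    simp
  | succ n =>
    have h0 := choose_succ_mul r (n + 1)
    simp [add_mul, coeff_derivative, coeff_succ_X_mul] at h0 ⊢
    linarith

theorem coeff_negBinomialSeries_succ (μ : ℝ) (n : ℕ) :
    (n + 1 : ℝ) * coeff (n + 1) (negBinomialSeries μ) =
      (μ + n) * coeff n (negBinomialSeries μ) := by
  have h0 := choose_succ_mul (-μ) n
  simp only [negBinomialSeries, coeff_rescale, binomialSeries_coeff, smul_eq_mul, mul_one, pow_succ]
  linear_combination (-(-1) ^ n) * h0

theorem derivative_negBinomialSeries (μ : ℝ) :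
    (1 - X) * d⁄dX ℝ (negBinomialSeries μ) = μ • negBinomialSeries μ := by
  ext n
  have h0 := coeff_negBinomialSeries_succ μ n
  cases n with
  | zero =>
    simp only [sub_mul, one_mul, map_sub, coeff_derivative, coeff_zero_X_mul, coeff_smul] at h0 ⊢
    simp at h0 ⊢
    linarith
  | succ n =>
    simp [sub_mul, coeff_derivative, coeff_succ_X_mul] at h0 ⊢
    linarith

theorem derivative_trapSeries (μ : ℝ) :
    (1 - X ^ 2) * d⁄dX ℝ (trapSeries μ) = (2 * μ) • trapSeries μ := by
  have h1 := derivative_binomialSeries μ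
  have h2 := derivative_negBinomialSeries μ
  simp only [trapSeries, Derivation.leibniz, derivative_C, smul_eq_mul, mul_zero, add_zero,
    smul_eq_C_mul, map_mul] at h1 h2 ⊢
  have : (C (2 : ℝ)) = (2 : ℝ⟦X⟧) := map_ofNat _ 2
  rw [this]
  linear_combination C ((2 : ℝ) ^ (-μ)) * negBinomialSeries μ * (1 - X) * h1 +
    C ((2 : ℝ) ^ (-μ)) * PowerSeries.binomialSeries ℝ μ * (1 + X) * h2

theorem coeff_zero_trapSeries (μ : ℝ) : coeff 0 (trapSeries μ) = 2 ^ (-μ) := by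
  rw [trapSeries, coeff_C_mul, coeff_mul]
  simp [negBinomialSeries, coeff_rescale]

theorem coeff_one_trapSeries (μ : ℝ) :
    coeff 1 (trapSeries μ) = 2 * μ * coeff 0 (trapSeries μ) := by
  have h := congrArg (coeff 0) (derivative_trapSeries μ)
  simpa only [sub_mul, coeff_derivative, pow_two, mul_assoc, coeff_zero_X_mul, one_mul, map_sub,
    sub_zero, coeff_smul, smul_eq_mul, Nat.cast_zero, zero_add, mul_one] using h

theorem coeff_trapSeries_rec (μ : ℝ) (n : ℕ) :
    (n + 2 : ℝ) * coeff (n + 2) (trapSeries μ) =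
      2 * μ * coeff (n + 1) (trapSeries μ) + n * coeff n (trapSeries μ) := by
  have h := congrArg (coeff (n + 1)) (derivative_trapSeries μ)
  cases n with
  | zero =>
    simp [sub_mul, coeff_derivative, pow_two, mul_assoc, coeff_succ_X_mul] at h ⊢
    linarith
  | succ n =>
    simp only [sub_mul, coeff_derivative, pow_two, mul_assoc, coeff_succ_X_mul, map_sub, one_mul,
      coeff_smul, smul_eq_mul] at h ⊢
    push_cast at h ⊢
    linarith

theorem coeff_trapSeries_pos {μ : ℝ} (hμ : 0 < μ) (n : ℕ) : 0 < coeff n (trapSeries μ) := by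
  have h0 : 0 < coeff 0 (trapSeries μ) := by rw [coeff_zero_trapSeries]; positivity
  induction n using Nat.strong_induction_on with
  | _ n ih =>
    match n with
    | 0 => exact h0
    | 1 => rw [coeff_one_trapSeries]; positivity
    | n + 2 =>
      have h1 := ih n (by omega)
      have h2 := ih (n + 1) (by omega)
      have h := coeff_trapSeries_rec μ n
      have : 0 < (n + 2 : ℝ) * coeff (n + 2) (trapSeries μ) := by rw [h]; positivity
      exact (pos_iff_pos_of_mul_pos this).1 (by positivity)

theorem coeff_succ_trapSeries_one (n : ℕ) : coeff (n + 1) (trapSeries 1) = 1 := by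
  have h0 := coeff_zero_trapSeries 1
  have h1 := coeff_one_trapSeries 1
  rw [h0, Real.rpow_neg_one] at h1
  induction n using Nat.strong_induction_on with
  | _ n ih =>
    match n with
    | 0 => rw [h1]; norm_num
    | 1 =>
      have h := coeff_trapSeries_rec 1 0
      simp at h ⊢
      rw [h1] at h
      linarith
    | n + 2 =>
      have h := coeff_trapSeries_rec 1 (n + 1)
      rw [ih n (by omega), ih (n + 1) (by omega)] at h
      push_cast at h
      have h3 : (n + 1 + 2 : ℝ) ≠ 0 := by positivity
      exact mul_left_cancel₀ h3 (by linarith)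

theorem coeff_succ_trapSeries_two (n : ℕ) : coeff (n + 1) (trapSeries 2) = n + 1 := by
  have h0 := coeff_zero_trapSeries 2
  have h1 := coeff_one_trapSeries 2
  rw [h0, Real.rpow_neg zero_le_two, Real.rpow_two] at h1
  induction n using Nat.strong_induction_on with
  | _ n ih =>
    match n with
    | 0 => rw [h1]; norm_num
    | 1 =>
      have h := coeff_trapSeries_rec 2 0
      simp at h ⊢
      rw [h1] at h
      linarith
    | n + 2 =>
      have h := coeff_trapSeries_rec 2 (n + 1)
      rw [ih n (by omega), ih (n + 1) (by omega)] at h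
      push_cast at h ⊢
      have h3 : (n + 1 + 2 : ℝ) ≠ 0 := by positivity
      exact mul_left_cancel₀ h3 (by linarith)

end

theorem isBigO_one_add_rpow_sub_one_sub_rpow (μ : ℝ) :
    (fun y : ℝ => (1 + y) ^ μ - (1 - y) ^ μ - 2 * μ * y) =O[𝓝 0] fun y => ‖y‖ ^ 3 := by
  have h1 := (Real.one_add_rpow_hasFPowerSeriesAt_zero (a := μ)).isBigO_sub_partialSum_pow 3
  have h2 : Tendsto (fun y : ℝ => -y) (𝓝 0) (𝓝 0) := by
    simpa using (continuous_neg (G := ℝ)).tendsto 0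
  have h3 := h1.sub ((h1.comp_tendsto h2).congr_right (g₂ := fun y : ℝ => ‖y‖ ^ 3)
    fun y => by simp)
  refine h3.congr_left fun y => ?_
  have hc : (binomialSeries ℝ μ).coeff 1 = μ := by
    simp [binomialSeries, FormalMultilinearSeries.coeff_ofScalars]
  simp [FormalMultilinearSeries.partialSum, sum_range_succ, hc, ← sub_eq_add_neg]
  ring

theorem exists_abs_central_diff_rpow_le (μ : ℝ) :
    ∃ K > 0, ∀ n : ℕ, 1 ≤ n →
      |((n : ℝ) + 1) ^ μ - ((n : ℝ) - 1) ^ μ - 2 * μ * (n : ℝ) ^ (μ - 1)| ≤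
        K * (n : ℝ) ^ (μ - 3) := by
  have h := (isBigO_one_add_rpow_sub_one_sub_rpow μ).comp_tendsto
    (tendsto_inv_atTop_nhds_zero_nat (𝕜 := ℝ))
  obtain ⟨K, hK, hb⟩ := Asymptotics.bound_of_isBigO_nat_atTop h
  refine ⟨K, hK, fun n hn => ?_⟩
  have hn0 : (0 : ℝ) < n := by exact_mod_cast hn
  have hn1 : (1 : ℝ) ≤ n := by exact_mod_cast hn
  have hinv : (n : ℝ)⁻¹ ≤ 1 := inv_le_one_of_one_le₀ hn1
  have h1 := hb (x := n) (by simp; omega)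
  simp only [Function.comp_apply, norm_pow, Real.norm_eq_abs, abs_inv, Nat.abs_cast] at h1
  have e1 : ((n : ℝ) + 1) ^ μ = (n : ℝ) ^ μ * (1 + (n : ℝ)⁻¹) ^ μ := by
    rw [← Real.mul_rpow hn0.le (by positivity)]
    congr 1; field_simp
  have e2 : ((n : ℝ) - 1) ^ μ = (n : ℝ) ^ μ * (1 - (n : ℝ)⁻¹) ^ μ := by
    rw [← Real.mul_rpow hn0.le (by linarith)]
    congr 1; field_simp
  have e3 : (n : ℝ) ^ (μ - 1) = (n : ℝ) ^ μ * (n : ℝ)⁻¹ := by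
    rw [Real.rpow_sub_one hn0.ne', div_eq_mul_inv]
  have e4 : (n : ℝ) ^ (μ - 3) = (n : ℝ) ^ μ * (n : ℝ)⁻¹ ^ 3 := by
    rw [Real.rpow_sub hn0, div_eq_mul_inv, inv_pow]
    norm_cast
  rw [e1, e2, e3, e4, show ∀ a b c d : ℝ, a * b - a * c - 2 * μ * (a * d) =
    a * (b - c - 2 * μ * d) by intros; ring, abs_mul, abs_of_nonneg (by positivity)]
  calc _ ≤ (n : ℝ) ^ μ * (K * (n : ℝ)⁻¹ ^ 3) := by gcongr
    _ = _ := by ring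

theorem rpow_le_three_rpow_mul_rpow {a b : ℝ} (x : ℝ) (ha : 0 < a) (hb : 0 < b)
    (hab : a ≤ 3 * b) (hba : b ≤ 3 * a) : a ^ x ≤ 3 ^ |x| * b ^ x := by
  rcases le_total 0 x with hx | hx
  · rw [abs_of_nonneg hx, ← Real.mul_rpow (by norm_num) hb.le]
    exact Real.rpow_le_rpow ha.le hab hx
  · rw [abs_of_nonpos hx, Real.rpow_neg (by norm_num), ← Real.inv_rpow (by norm_num),
      ← Real.mul_rpow (by norm_num) hb.le]
    exact Real.rpow_le_rpow_of_nonpos (by positivity) (by linarith) hx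

theorem min_mul_rpow_sub_one_le {s : ℝ} (hs : 0 < s) (n : ℕ) :
    min s 1 * ((n : ℝ) + 1) ^ (s - 1) ≤ ((n : ℝ) + 1) ^ s - (n : ℝ) ^ s := by
  set x : ℝ := (n : ℝ) + 1 with hx
  have hx1 : 1 ≤ x := by rw [hx]; linarith [n.cast_nonneg (α := ℝ)]
  have hx0 : 0 < x := by linarith
  have hinv : x⁻¹ ≤ 1 := inv_le_one_of_one_le₀ hx1
  have e : (n : ℝ) ^ s = x ^ s * (1 + -x⁻¹) ^ s := by
    rw [← Real.mul_rpow hx0.le (by linarith)]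
    congr 1; field_simp; rw [hx]; ring
  have key : (1 + -x⁻¹) ^ s ≤ 1 - min s 1 * x⁻¹ := by
    rcases le_total s 1 with h | h
    · rw [min_eq_left h]
      have := rpow_one_add_le_one_add_mul_self (s := -x⁻¹) (by linarith) hs.le h
      linarith
    · rw [min_eq_right h]
      have h0 : 0 ≤ 1 + -x⁻¹ := by linarith
      have := Real.rpow_le_rpow_of_exponent_ge' h0 (by simp; positivity) zero_le_one h
      rw [Real.rpow_one] at this
      linarith
  rw [e, Real.rpow_sub_one hx0.ne', div_eq_mul_inv]
  have := mul_le_mul_of_nonneg_left key (Real.rpow_nonneg hx0.le s)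
  linarith

theorem exists_sum_rpow_sub_one_le {s : ℝ} (hs : s ≠ 0) :
    ∃ C > 0, ∀ n : ℕ, ∑ k ∈ range n, ((k : ℝ) + 1) ^ (s - 1) ≤ C * (1 + (n : ℝ) ^ s) := by
  rcases hs.lt_or_gt with h | h
  · have hsum : Summable fun k : ℕ => ((k : ℝ) + 1) ^ (s - 1) := by
      have := (summable_nat_add_iff 1).2 (Real.summable_nat_rpow.2 (show s - 1 < -1 by linarith))
      exact_mod_cast this
    refine ⟨∑' k : ℕ, ((k : ℝ) + 1) ^ (s - 1) + 1, ?_, fun n => ?_⟩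
    · have : 0 ≤ ∑' k : ℕ, ((k : ℝ) + 1) ^ (s - 1) := tsum_nonneg fun k => by positivity
      linarith
    · have h1 := hsum.sum_le_tsum (range n) fun k _ => by positivity
      have h2 : 0 ≤ ∑' k : ℕ, ((k : ℝ) + 1) ^ (s - 1) := tsum_nonneg fun k => by positivity
      have h3 : (0 : ℝ) ≤ (n : ℝ) ^ s := by positivity
      nlinarith
  · have hm : 0 < min s 1 := lt_min h one_pos
    refine ⟨(min s 1)⁻¹, by positivity, fun n => ?_⟩
    have : min s 1 * ∑ k ∈ range n, ((k : ℝ) + 1) ^ (s - 1) ≤ (n : ℝ) ^ s := by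
      induction n with
      | zero => simp [Real.zero_rpow h.ne']
      | succ n ih =>
        rw [sum_range_succ, mul_add]
        have := min_mul_rpow_sub_one_le h n
        push_cast
        linarith
    rw [inv_mul_eq_div, le_div_iff₀ hm]
    linarith

theorem exists_conv_rpow_le {b s : ℝ} (hb : 0 < b) (hs : s ≠ 0) :
    ∃ C > 0, ∀ n : ℕ, 1 ≤ n →
      ∑ k ∈ range (n + 1), (((n - k : ℕ) : ℝ) + 1) ^ (b - 1) * ((k : ℝ) + 1) ^ (s - 1) ≤
        C * ((n : ℝ) ^ (b + s - 1) + (n : ℝ) ^ (b - 1)) := by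
  obtain ⟨A, hA, hsA⟩ := exists_sum_rpow_sub_one_le hs
  obtain ⟨B, hB, hsB⟩ := exists_sum_rpow_sub_one_le hb.ne'
  refine ⟨3 ^ |b - 1| * (A * (1 + 3 ^ |s|)) + 3 ^ |s - 1| * (B * (1 + 3 ^ |b|)),
    by positivity, fun n hn => ?_⟩
  have hn1 : (1 : ℝ) ≤ n := by exact_mod_cast hn
  have hn0 : (0 : ℝ) < n := by linarith
  have pw : ∀ k ∈ range (n + 1),
      (((n - k : ℕ) : ℝ) + 1) ^ (b - 1) * ((k : ℝ) + 1) ^ (s - 1) ≤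
        3 ^ |b - 1| * (n : ℝ) ^ (b - 1) * ((k : ℝ) + 1) ^ (s - 1) +
        3 ^ |s - 1| * (n : ℝ) ^ (s - 1) * (((n - k : ℕ) : ℝ) + 1) ^ (b - 1) := by
    intro k hk
    have hk' : k ≤ n := by simpa [Nat.lt_succ_iff] using hk
    have hkn : (k : ℝ) ≤ n := by exact_mod_cast hk'
    rw [Nat.cast_sub hk']
    have hk0 : (0 : ℝ) ≤ k := k.cast_nonneg
    have p1 : (0 : ℝ) < k + 1 := by positivity
    have p2 : (0 : ℝ) < (n - k : ℝ) + 1 := by linarith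
    have q1 : 0 ≤ ((k : ℝ) + 1) ^ (s - 1) := by positivity
    have q2 : 0 ≤ ((n - k : ℝ) + 1) ^ (b - 1) := by positivity
    rcases le_total (2 * (k : ℝ)) n with h | h
    · have := rpow_le_three_rpow_mul_rpow (b - 1) p2 hn0 (by linarith) (by linarith)
      have h2 : 0 ≤ 3 ^ |s - 1| * (n : ℝ) ^ (s - 1) * ((n - k : ℝ) + 1) ^ (b - 1) := by positivity
      have := mul_le_mul_of_nonneg_right this q1
      linarith
    · have := rpow_le_three_rpow_mul_rpow (s - 1) p1 hn0 (by linarith) (by linarith)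
      have h2 : 0 ≤ 3 ^ |b - 1| * (n : ℝ) ^ (b - 1) * ((k : ℝ) + 1) ^ (s - 1) := by positivity
      have := mul_le_mul_of_nonneg_right this q2
      linarith
  have h1 := hsA (n + 1)
  have h2 := hsB (n + 1)
  have h3 : ((n + 1 : ℕ) : ℝ) ^ s ≤ 3 ^ |s| * (n : ℝ) ^ s :=
    rpow_le_three_rpow_mul_rpow s (by positivity) hn0 (by push_cast; linarith)
      (by push_cast; linarith)
  have h4 : ((n + 1 : ℕ) : ℝ) ^ b ≤ 3 ^ |b| * (n : ℝ) ^ b :=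
    rpow_le_three_rpow_mul_rpow b (by positivity) hn0 (by push_cast; linarith)
      (by push_cast; linarith)
  have h5 : 1 ≤ (n : ℝ) ^ b := Real.one_le_rpow hn1 hb.le
  have hrefl : ∑ k ∈ range (n + 1), (((n - k : ℕ) : ℝ) + 1) ^ (b - 1) =
      ∑ k ∈ range (n + 1), ((k : ℝ) + 1) ^ (b - 1) := by
    rw [← sum_range_reflect]
    refine sum_congr rfl fun k hk => ?_
    congr 3; have := mem_range.1 hk; omega
  have e1 : (n : ℝ) ^ (b - 1) * (n : ℝ) ^ s = (n : ℝ) ^ (b + s - 1) := by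
    rw [← Real.rpow_add hn0]; ring_nf
  have e2 : (n : ℝ) ^ (s - 1) * (n : ℝ) ^ b = (n : ℝ) ^ (b + s - 1) := by
    rw [← Real.rpow_add hn0]; ring_nf
  refine (sum_le_sum pw).trans ?_
  rw [sum_add_distrib, ← mul_sum, ← mul_sum, hrefl]
  have t1 : (n : ℝ) ^ (b - 1) * ∑ k ∈ range (n + 1), ((k : ℝ) + 1) ^ (s - 1) ≤
      A * (1 + 3 ^ |s|) * ((n : ℝ) ^ (b + s - 1) + (n : ℝ) ^ (b - 1)) := by
    calc _ ≤ (n : ℝ) ^ (b - 1) * (A * (1 + 3 ^ |s| * (n : ℝ) ^ s)) := by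
          gcongr; exact h1.trans (by gcongr)
      _ = A * ((n : ℝ) ^ (b - 1) + 3 ^ |s| * (n : ℝ) ^ (b + s - 1)) := by rw [← e1]; ring
      _ ≤ A * ((1 + 3 ^ |s|) * ((n : ℝ) ^ (b + s - 1) + (n : ℝ) ^ (b - 1))) := by
          gcongr
          have : 0 ≤ 3 ^ |s| * (n : ℝ) ^ (b - 1) := by positivity
          have : 0 ≤ (n : ℝ) ^ (b + s - 1) := by positivity
          linarith
      _ = _ := by ring
  have t2 : (n : ℝ) ^ (s - 1) * ∑ k ∈ range (n + 1), ((k : ℝ) + 1) ^ (b - 1) ≤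
      B * (1 + 3 ^ |b|) * ((n : ℝ) ^ (b + s - 1) + (n : ℝ) ^ (b - 1)) := by
    calc _ ≤ (n : ℝ) ^ (s - 1) * (B * ((n : ℝ) ^ b + 3 ^ |b| * (n : ℝ) ^ b)) := by
          gcongr; exact h2.trans (by gcongr)
      _ = B * (1 + 3 ^ |b|) * (n : ℝ) ^ (b + s - 1) := by rw [← e2]; ring
      _ ≤ _ := by
          gcongr
          have : 0 ≤ (n : ℝ) ^ (b - 1) := by positivity
          linarith
  have t1' := mul_le_mul_of_nonneg_left t1 (show (0 : ℝ) ≤ 3 ^ |b - 1| by positivity)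
  have t2' := mul_le_mul_of_nonneg_left t2 (show (0 : ℝ) ≤ 3 ^ |s - 1| by positivity)
  linarith

theorem exists_abs_central_diff_succ_rpow_le (μ : ℝ) :
    ∃ K > 0, ∀ n : ℕ,
      |((n : ℝ) + 2) ^ μ - (n : ℝ) ^ μ - 2 * μ * ((n : ℝ) + 1) ^ (μ - 1)| ≤
        K * (((n : ℝ) + 1) ^ μ / ((n : ℝ) + 1) ^ 3) := by
  obtain ⟨K, hK, h⟩ := exists_abs_central_diff_rpow_le μ
  refine ⟨K, hK, fun n => ?_⟩
  have h1 := h (n + 1) (by omega)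
  have h0 : (0 : ℝ) < (n : ℝ) + 1 := by positivity
  push_cast at h1
  rw [Real.rpow_sub h0 μ 3, add_sub_cancel_right, add_assoc, one_add_one_eq_two] at h1
  exact_mod_cast h1

/-- The three-term recurrence satisfied by `y n = w n / n ^ (μ - 1)`, where the `w n` are the Taylor
coefficients of `((1 + z) / (2 (1 - z))) ^ μ`. -/
def IsTrapRatio (μ : ℝ) (y : ℕ → ℝ) : Prop :=
  ∀ n : ℕ, ((n : ℝ) + 2) ^ μ * y (n + 2) =
    (n : ℝ) ^ μ * y n + 2 * μ * ((n : ℝ) + 1) ^ (μ - 1) * y (n + 1)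

theorem IsTrapRatio.exists_le {μ : ℝ} {y : ℕ → ℝ} (hμ : 0 < μ) (hy : ∀ n, 0 ≤ y n)
    (h : IsTrapRatio μ y) : ∃ M > 0, ∀ n, y n ≤ M := by
  obtain ⟨K, hK, hr⟩ := exists_abs_central_diff_succ_rpow_le μ
  have hsum : Summable fun k : ℕ => (1 : ℝ) / ((k : ℝ) + 1) ^ 3 := by
    have := (summable_nat_add_iff 1).2 (Real.summable_one_div_nat_pow.2 (show 1 < 3 by norm_num))
    exact_mod_cast this
  set E : ℕ → ℝ := fun n => Real.exp (K * ∑ k ∈ range n, (1 : ℝ) / ((k : ℝ) + 1) ^ 3) with hE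
  set M : ℝ := max (y 0) (y 1) + 1 with hM
  have hM0 : 0 < M := by have := hy 0; have := le_max_left (y 0) (y 1); linarith
  have hE0 : ∀ n, 0 < E n := fun n => Real.exp_pos _
  have hEs : ∀ n : ℕ, E n * (1 + K * (1 / ((n : ℝ) + 1) ^ 3)) ≤ E (n + 1) := by
    intro n
    simp only [hE, sum_range_succ, mul_add, Real.exp_add]
    have := Real.add_one_le_exp (K * (1 / ((n : ℝ) + 1) ^ 3))
    have h2 := Real.exp_pos (K * ∑ k ∈ range n, (1 : ℝ) / ((k : ℝ) + 1) ^ 3)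
    nlinarith
  have hEm : ∀ n : ℕ, E n ≤ E (n + 1) := by
    intro n
    refine le_trans ?_ (hEs n)
    have : 0 ≤ K * (1 / ((n : ℝ) + 1) ^ 3) := by positivity
    have := hE0 n
    nlinarith
  have key : ∀ n, y n ≤ M * E n ∧ y (n + 1) ≤ M * E n := by
    intro n
    induction n with
    | zero =>
      have h1 := le_max_left (y 0) (y 1)
      have h2 := le_max_right (y 0) (y 1)
      simp only [hE, range_zero, sum_empty, mul_zero, Real.exp_zero, mul_one]
      constructor <;> linarith
    | succ n ih =>
      refine ⟨ih.2.trans (by gcongr; exact hEm n), ?_⟩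
      have h2 : (0 : ℝ) < ((n : ℝ) + 2) ^ μ := by positivity
      have hmon : ((n : ℝ) + 1) ^ μ ≤ ((n : ℝ) + 2) ^ μ := by gcongr; norm_num
      refine le_trans (le_of_mul_le_mul_left ?_ h2) (mul_le_mul_of_nonneg_left (hEs n) hM0.le)
      have h3 := (abs_le.1 (hr n)).1
      have h5 : ((n : ℝ) + 1) ^ μ / ((n : ℝ) + 1) ^ 3 ≤
        ((n : ℝ) + 2) ^ μ / ((n : ℝ) + 1) ^ 3 := by gcongr
      have h6 : 0 < M * E n := mul_pos hM0 (hE0 n)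
      calc _ = (n : ℝ) ^ μ * y n + 2 * μ * ((n : ℝ) + 1) ^ (μ - 1) * y (n + 1) := h n
        _ ≤ (n : ℝ) ^ μ * (M * E n) + 2 * μ * ((n : ℝ) + 1) ^ (μ - 1) * (M * E n) := by
            gcongr
            exacts [ih.1, ih.2]
        _ = ((n : ℝ) ^ μ + 2 * μ * ((n : ℝ) + 1) ^ (μ - 1)) * (M * E n) := by ring
        _ ≤ (((n : ℝ) + 2) ^ μ + K * (((n : ℝ) + 2) ^ μ / ((n : ℝ) + 1) ^ 3)) * (M * E n) := by
            refine mul_le_mul_of_nonneg_right ?_ h6.le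
            have := mul_le_mul_of_nonneg_left h5 hK.le
            linarith
        _ = _ := by ring
  refine ⟨M * Real.exp (K * ∑' k : ℕ, (1 : ℝ) / ((k : ℝ) + 1) ^ 3), by positivity, fun n => ?_⟩
  refine (key n).1.trans ?_
  simp only [hE]
  gcongr
  exact hsum.sum_le_tsum _ fun k _ => by positivity

theorem IsTrapRatio.exists_abs_sub_le {μ : ℝ} {y : ℕ → ℝ} (hμ : 1 < μ) (hy : ∀ n, 0 ≤ y n)
    (h : IsTrapRatio μ y) :
    ∃ C > 0, ∀ n : ℕ, 1 ≤ n → |y (n + 1) - y n| ≤ C / (n : ℝ) ^ 2 := by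
  obtain ⟨K, hK, hr⟩ := exists_abs_central_diff_succ_rpow_le μ
  obtain ⟨M, hM, hyM⟩ := h.exists_le (by linarith) hy
  obtain ⟨A, hA, hsA⟩ := exists_sum_rpow_sub_one_le (s := 2 * μ - 2) (by linarith)
  have step : ∀ n : ℕ, ((n : ℝ) + 1) ^ μ * ((n : ℝ) + 2) ^ μ * |y (n + 2) - y (n + 1)| ≤
      (n : ℝ) ^ μ * ((n : ℝ) + 1) ^ μ * |y (n + 1) - y n| +
        K * M * ((n : ℝ) + 1) ^ (2 * μ - 2 - 1) := by
    intro n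
    have h1 : (0 : ℝ) < (n : ℝ) + 1 := by positivity
    have e : ((n : ℝ) + 2) ^ μ * (y (n + 2) - y (n + 1)) =
        -((n : ℝ) ^ μ * (y (n + 1) - y n)) -
        (((n : ℝ) + 2) ^ μ - (n : ℝ) ^ μ - 2 * μ * ((n : ℝ) + 1) ^ (μ - 1)) * y (n + 1) := by
      linear_combination h n
    have e2 : ((n : ℝ) + 2) ^ μ * |y (n + 2) - y (n + 1)| ≤
        (n : ℝ) ^ μ * |y (n + 1) - y n| + K * (((n : ℝ) + 1) ^ μ / ((n : ℝ) + 1) ^ 3) * M := by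
      rw [← abs_of_pos (show (0 : ℝ) < ((n : ℝ) + 2) ^ μ by positivity), ← abs_mul, e]
      refine (abs_sub _ _).trans ?_
      rw [abs_neg, abs_mul, abs_mul, abs_of_nonneg (show (0 : ℝ) ≤ (n : ℝ) ^ μ by positivity),
        abs_of_nonneg (hy (n + 1))]
      gcongr
      exacts [hy _, hr n, hyM _]
    have e3 : ((n : ℝ) + 1) ^ (2 * μ - 2 - 1) =
        ((n : ℝ) + 1) ^ μ * (((n : ℝ) + 1) ^ μ / ((n : ℝ) + 1) ^ 3) := by
      rw [show 2 * μ - 2 - 1 = μ + μ - (3 : ℕ) by push_cast; ring, Real.rpow_sub h1,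
        Real.rpow_add h1, Real.rpow_natCast]
      ring
    have := mul_le_mul_of_nonneg_left e2 (show (0 : ℝ) ≤ ((n : ℝ) + 1) ^ μ by positivity)
    rw [e3]
    linarith
  have acc : ∀ n : ℕ, (n : ℝ) ^ μ * ((n : ℝ) + 1) ^ μ * |y (n + 1) - y n| ≤
      K * M * ∑ k ∈ range n, ((k : ℝ) + 1) ^ (2 * μ - 2 - 1) := by
    intro n
    induction n with
    | zero => simp [Real.zero_rpow (show μ ≠ 0 by linarith)]
    | succ n ih =>
      have := step n
      rw [sum_range_succ, mul_add]
      push_cast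
      rw [add_assoc (n : ℝ) 1 1, one_add_one_eq_two]
      linarith
  refine ⟨K * M * (A * 2), by positivity, fun n hn => ?_⟩
  have hn1 : (1 : ℝ) ≤ n := by exact_mod_cast hn
  have hn0 : (0 : ℝ) < n := by linarith
  have h1 : 1 ≤ (n : ℝ) ^ (2 * μ - 2) := Real.one_le_rpow hn1 (by linarith)
  have e : (n : ℝ) ^ (2 * μ - 2) = (n : ℝ) ^ μ * (n : ℝ) ^ μ / (n : ℝ) ^ 2 := by
    rw [show 2 * μ - 2 = μ + μ - (2 : ℕ) by push_cast; ring, Real.rpow_sub hn0,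
        Real.rpow_add hn0, Real.rpow_natCast]
  have hp : (0 : ℝ) < (n : ℝ) ^ μ * (n : ℝ) ^ μ := by positivity
  refine le_of_mul_le_mul_left ?_ hp
  calc (n : ℝ) ^ μ * (n : ℝ) ^ μ * |y (n + 1) - y n|
      ≤ (n : ℝ) ^ μ * ((n : ℝ) + 1) ^ μ * |y (n + 1) - y n| := by gcongr; linarith
    _ ≤ K * M * (A * (1 + (n : ℝ) ^ (2 * μ - 2))) := (acc n).trans (by gcongr; exact hsA n)
    _ ≤ K * M * (A * (2 * (n : ℝ) ^ (2 * μ - 2))) := by gcongr; linarith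
    _ = _ := by rw [e]; ring

theorem IsTrapRatio.exists_abs_sub_two_le {μ : ℝ} {y : ℕ → ℝ} (hμ : 1 < μ) (hy : ∀ n, 0 ≤ y n)
    (h : IsTrapRatio μ y) :
    ∃ C > 0, ∀ n : ℕ, 1 ≤ n → |y (n + 2) - y n| ≤ C / ((n : ℝ) + 1) ^ 3 := by
  obtain ⟨K, hK, hr⟩ := exists_abs_central_diff_succ_rpow_le μ
  obtain ⟨M, hM, hyM⟩ := h.exists_le (by linarith) hy
  obtain ⟨A, hA, hd⟩ := h.exists_abs_sub_le hμ hy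
  refine ⟨(2 * μ + K) * (4 * A) + K * M, by positivity, fun n hn => ?_⟩
  have hn1 : (1 : ℝ) ≤ n := by exact_mod_cast hn
  have hn0 : (0 : ℝ) < n := by linarith
  have h1 : (0 : ℝ) < (n : ℝ) + 1 := by positivity
  set a : ℝ := (n : ℝ) + 1 with ha
  have e : ((n : ℝ) + 2) ^ μ * (y (n + 2) - y n) =
      (((n : ℝ) + 2) ^ μ - (n : ℝ) ^ μ) * (y (n + 1) - y n) -
      (((n : ℝ) + 2) ^ μ - (n : ℝ) ^ μ - 2 * μ * a ^ (μ - 1)) * y (n + 1) := by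
    linear_combination h n
  have d1 : |y (n + 1) - y n| ≤ 4 * A / a ^ 2 := by
    refine (hd n hn).trans ?_
    rw [div_le_div_iff₀ (by positivity) (by positivity)]
    have : a ^ 2 ≤ 4 * (n : ℝ) ^ 2 := by rw [ha]; nlinarith
    nlinarith
  have d2 : |((n : ℝ) + 2) ^ μ - (n : ℝ) ^ μ| ≤ (2 * μ + K) * (a ^ μ / a) := by
    have e1 : a ^ (μ - 1) = a ^ μ / a := Real.rpow_sub_one h1.ne' μ
    have e2 : a ^ μ / a ^ 3 ≤ a ^ μ / a := by
      gcongr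
      exact le_self_pow₀ (by linarith) (by norm_num)
    have e3 := hr n
    rw [e1] at e3
    have e4 : 0 ≤ 2 * μ * (a ^ μ / a) := by positivity
    have e5 := mul_le_mul_of_nonneg_left e2 hK.le
    have e6 : 0 ≤ K * (a ^ μ / a ^ 3) := by positivity
    rw [abs_le] at e3 ⊢
    constructor <;> linarith
  have hmon : a ^ μ ≤ ((n : ℝ) + 2) ^ μ := by rw [ha]; gcongr; norm_num
  have hp : 0 < a ^ μ := by positivity
  refine le_of_mul_le_mul_left ?_ hp
  calc a ^ μ * |y (n + 2) - y n| ≤ ((n : ℝ) + 2) ^ μ * |y (n + 2) - y n| := by gcongr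
    _ = |((n : ℝ) + 2) ^ μ * (y (n + 2) - y n)| := by
        rw [abs_mul, abs_of_pos (show (0 : ℝ) < ((n : ℝ) + 2) ^ μ by positivity)]
    _ ≤ (2 * μ + K) * (a ^ μ / a) * (4 * A / a ^ 2) + K * (a ^ μ / a ^ 3) * M := by
        rw [e]
        refine (abs_sub _ _).trans ?_
        rw [abs_mul, abs_mul, abs_of_nonneg (hy (n + 1))]
        gcongr
        exacts [hy _, hr n, hyM _]
    _ = _ := by field_simp

theorem abs_sub_le_of_abs_sub_two_le {y : ℕ → ℝ} {c C : ℝ} (hC : 0 < C)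
    (hc : Tendsto y atTop (𝓝 c))
    (h : ∀ n : ℕ, 1 ≤ n → |y (n + 2) - y n| ≤ C / ((n : ℝ) + 1) ^ 3) (n : ℕ) (hn : 1 ≤ n) :
    |y n - c| ≤ C / (n : ℝ) ^ 2 := by
  have hn0 : (0 : ℝ) < n := by exact_mod_cast hn
  have key : ∀ j : ℕ, |y n - y (n + 2 * j)| ≤ C / (n : ℝ) ^ 2 - C / ((n : ℝ) + 2 * j) ^ 2 := by
    intro j
    induction j with
    | zero => simp
    | succ j ih =>
      have h1 := h (n + 2 * j) (by omega)
      push_cast at h1 ⊢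
      set x : ℝ := (n : ℝ) + 2 * j with hx
      have hx0 : 0 < x := by positivity
      have h2 : C / (x + 1) ^ 3 ≤ C / x ^ 2 - C / (x + 2) ^ 2 := by
        rw [div_sub_div _ _ (by positivity) (by positivity),
          div_le_div_iff₀ (by positivity) (by positivity), ← sub_nonneg]
        have : (C * (x + 2) ^ 2 - x ^ 2 * C) * (x + 1) ^ 3 - C * (x ^ 2 * (x + 2) ^ 2) =
          C * (3 * x ^ 4 + 12 * x ^ 3 + 20 * x ^ 2 + 16 * x + 4) := by ring
        rw [this]
        positivity
      have h3 := abs_sub_le (y n) (y (n + 2 * j)) (y (n + 2 * (j + 1)))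
      rw [abs_sub_comm (y (n + 2 * j)), show n + 2 * (j + 1) = n + 2 * j + 2 by ring] at h3
      rw [show (n : ℝ) + 2 * ((j : ℝ) + 1) = x + 2 by rw [hx]; ring,
        show n + 2 * (j + 1) = n + 2 * j + 2 by ring]
      linarith
  have ht : Tendsto (fun j : ℕ => |y n - y (n + 2 * j)|) atTop (𝓝 |y n - c|) := by
    refine (tendsto_const_nhds.sub (hc.comp ?_)).abs
    exact tendsto_atTop_mono (fun j => by simp only [id_eq]; omega) tendsto_id
  refine le_of_tendsto' ht fun j => (key j).trans ?_
  have : 0 ≤ C / ((n : ℝ) + 2 * j) ^ 2 := by positivity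
  linarith

open PowerSeries

theorem coeff_negBinomialSeries_eq (μ : ℝ) (n : ℕ) :
    coeff n (negBinomialSeries μ) = (∏ i ∈ range n, (μ + i)) / n.factorial := by
  induction n with
  | zero => simp [negBinomialSeries]
  | succ n ih =>
    have h := coeff_negBinomialSeries_succ μ n
    have h1 : (n + 1 : ℝ) ≠ 0 := by positivity
    have h2 : (n.factorial : ℝ) ≠ 0 := by positivity
    apply mul_left_cancel₀ h1
    rw [h, ih, prod_range_succ, Nat.factorial_succ]
    push_cast
    field_simp

theorem coeff_negBinomialSeries_pos {μ : ℝ} (hμ : 0 < μ) (n : ℕ) :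
    0 < coeff n (negBinomialSeries μ) := by
  rw [coeff_negBinomialSeries_eq]
  exact div_pos (prod_pos fun i _ => by positivity) (by positivity)

theorem monotone_coeff_negBinomialSeries {μ : ℝ} (hμ : 1 ≤ μ) :
    Monotone fun n => coeff n (negBinomialSeries μ) := by
  refine monotone_nat_of_le_succ fun n => ?_
  have h := coeff_negBinomialSeries_succ μ n
  have hp := coeff_negBinomialSeries_pos (by linarith : 0 < μ) n
  have h1 : (0 : ℝ) < n + 1 := by positivity
  refine le_of_mul_le_mul_left ?_ h1
  rw [h]
  exact mul_le_mul_of_nonneg_right (by linarith) hp.le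

theorem tendsto_coeff_negBinomialSeries_div {μ : ℝ} (hμ : 0 < μ) :
    Tendsto (fun n : ℕ => coeff n (negBinomialSeries μ) / (n : ℝ) ^ (μ - 1)) atTop
      (𝓝 (Real.Gamma μ)⁻¹) := by
  have h1 := (Real.GammaSeq_tendsto_Gamma μ).inv₀ (Real.Gamma_pos_of_pos hμ).ne'
  have h2 : Tendsto (fun n : ℕ => (n : ℝ) / (n + μ)) atTop (𝓝 1) :=
    tendsto_natCast_div_add_atTop μ
  have h3 := h1.mul h2
  rw [mul_one] at h3
  refine h3.congr' ?_
  filter_upwards [eventually_ge_atTop 1] with n hn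
  have hn0 : (0 : ℝ) < n := by exact_mod_cast hn
  have hne : (n : ℝ) + μ ≠ 0 := by positivity
  have h4 : (n.factorial : ℝ) ≠ 0 := by positivity
  have h5 : (n : ℝ) ^ μ ≠ 0 := by positivity
  rw [coeff_negBinomialSeries_eq, Real.GammaSeq, Real.rpow_sub_one hn0.ne', prod_range_succ,
    add_comm μ (n : ℝ)]
  field_simp

theorem summable_choose {μ : ℝ} (hμ : 0 < μ) : Summable fun n => Ring.choose μ n := by
  obtain ⟨N, hN⟩ := exists_nat_ge μ
  set g : ℕ → ℝ := fun n => |Ring.choose μ n| with hg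
  have hrec : ∀ n, N ≤ n → μ * g n = n * g n - ((n : ℝ) + 1) * g (n + 1) := by
    intro n hn
    have h := congrArg abs (choose_succ_mul μ n)
    have hn' : μ ≤ n := hN.trans (by exact_mod_cast hn)
    rw [abs_mul, abs_mul, abs_of_pos (by positivity : (0 : ℝ) < n + 1),
      abs_of_nonpos (by linarith : μ - n ≤ 0)] at h
    simp only [hg]
    linarith
  have hsum : ∀ m, μ * ∑ k ∈ range m, g (k + N) = N * g N - ((m + N : ℕ) : ℝ) * g (m + N) := by
    intro m
    induction m with
    | zero => simp
    | succ m ih =>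
      have := hrec (m + N) (by omega)
      rw [sum_range_succ, mul_add, ih, this, show m + 1 + N = m + N + 1 by ring]
      push_cast
      ring
  refine Summable.of_abs ((summable_nat_add_iff N).1 ?_)
  refine summable_of_sum_range_le (c := N * g N / μ) (fun n => abs_nonneg _) fun m => ?_
  rw [le_div_iff₀ hμ, mul_comm]
  refine (hsum m).le.trans ?_
  have : 0 ≤ ((m + N : ℕ) : ℝ) * g (m + N) := by positivity
  linarith

theorem tsum_choose {μ : ℝ} (hμ : 0 < μ) : ∑' n, Ring.choose μ n = 2 ^ μ := by
  have h1 := Real.tendsto_tsum_powerSeries_nhdsWithin_lt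
    (summable_choose hμ).hasSum.tendsto_sum_nat
  have h2 : Tendsto (fun x : ℝ => (1 + x) ^ μ) (𝓝[<] 1) (𝓝 (2 ^ μ)) := by
    have : ContinuousAt (fun x : ℝ => (1 + x) ^ μ) 1 :=
      (continuousAt_const.add continuousAt_id).rpow_const (Or.inr hμ.le)
    have h := this.tendsto.mono_left (nhdsWithin_le_nhds (s := Set.Iio 1))
    rwa [one_add_one_eq_two] at h
  refine tendsto_nhds_unique h1 (h2.congr' ?_)
  filter_upwards [Ioo_mem_nhdsLT (show (0 : ℝ) < 1 by norm_num)] with x hx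
  have hxb : x ∈ Metric.eball (0 : ℝ) 1 := by
    rw [Metric.mem_eball, edist_zero_right, ← ofReal_norm, Real.norm_of_nonneg hx.1.le]
    simpa using hx.2
  have h := (Real.one_add_rpow_hasFPowerSeriesOnBall_zero (a := μ)).hasSum hxb
  have := h.tsum_eq
  simp only [zero_add] at this
  rw [← this]
  refine tsum_congr fun n => ?_
  simp [_root_.binomialSeries, FormalMultilinearSeries.coeff_ofScalars, mul_comm]

theorem tendsto_coeff_trapSeries_div {μ : ℝ} (hμ : 1 < μ) :
    Tendsto (fun n : ℕ => coeff n (trapSeries μ) / (n : ℝ) ^ (μ - 1)) atTop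
      (𝓝 (Real.Gamma μ)⁻¹) := by
  have hμ0 : 0 < μ := by linarith
  set p : ℕ → ℝ := fun n => coeff n (negBinomialSeries μ) with hp
  have hp0 : ∀ n, 0 < p n := coeff_negBinomialSeries_pos hμ0
  have hpm : Monotone p := monotone_coeff_negBinomialSeries hμ.le
  have hlim := tendsto_coeff_negBinomialSeries_div hμ0
  obtain ⟨B, hB⟩ := hlim.bddAbove_range
  have hshift : ∀ j : ℕ, Tendsto (fun n : ℕ => p (n - j) / (n : ℝ) ^ (μ - 1)) atTop
      (𝓝 (Real.Gamma μ)⁻¹) := by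
    intro j
    rw [← tendsto_add_atTop_iff_nat j]
    have h1 : Tendsto (fun n : ℕ => ((n : ℝ) / (n + j)) ^ (μ - 1)) atTop (𝓝 1) := by
      have := (tendsto_natCast_div_add_atTop (j : ℝ)).rpow_const (p := μ - 1) (Or.inl one_ne_zero)
      rwa [Real.one_rpow] at this
    have h2 := hlim.mul h1
    rw [mul_one] at h2
    refine h2.congr' ?_
    filter_upwards [eventually_ge_atTop 1] with n hn
    have hn0 : (0 : ℝ) < n := by exact_mod_cast hn
    rw [Real.div_rpow hn0.le (by positivity), Nat.add_sub_cancel]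
    have : (n : ℝ) ^ (μ - 1) ≠ 0 := by positivity
    push_cast
    field_simp
    rfl
  have htan : Tendsto (fun n : ℕ => ∑' j, if j ≤ n then
      Ring.choose μ j * (p (n - j) / (n : ℝ) ^ (μ - 1)) else 0) atTop
      (𝓝 (∑' j, Ring.choose μ j * (Real.Gamma μ)⁻¹)) := by
    refine tendsto_tsum_of_dominated_convergence (bound := fun j => |Ring.choose μ j| * B)
      ((summable_choose hμ0).abs.mul_right B) (fun j => ?_) (Eventually.of_forall fun n j => ?_)
    · refine ((hshift j).const_mul (Ring.choose μ j)).congr' ?_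
      filter_upwards [eventually_ge_atTop j] with n hn
      rw [if_pos hn]
    · have hnn : (0 : ℝ) ≤ (n : ℝ) ^ (μ - 1) := by positivity
      have hBn : p n / (n : ℝ) ^ (μ - 1) ≤ B := hB ⟨n, rfl⟩
      split_ifs with h
      · rw [norm_mul, Real.norm_eq_abs, Real.norm_of_nonneg (div_nonneg (hp0 _).le hnn)]
        refine mul_le_mul_of_nonneg_left (le_trans ?_ hBn) (abs_nonneg _)
        exact div_le_div_of_nonneg_right (hpm (Nat.sub_le n j)) hnn
      · rw [norm_zero]
        exact mul_nonneg (abs_nonneg _) ((div_nonneg (hp0 _).le hnn).trans hBn)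
  rw [tsum_mul_right, tsum_choose hμ0] at htan
  have h := htan.const_mul ((2 : ℝ) ^ (-μ))
  rw [← mul_assoc, ← Real.rpow_add two_pos, neg_add_cancel, Real.rpow_zero, one_mul] at h
  refine h.congr fun n => ?_
  rw [tsum_eq_sum (s := range (n + 1)) fun j hj => if_neg (by simpa using hj), trapSeries,
    coeff_C_mul, mul_comm (negBinomialSeries μ), coeff_mul,
    Finset.Nat.sum_antidiagonal_eq_sum_range_succ_mk, mul_div_assoc, sum_div]
  congr 1
  refine sum_congr rfl fun j hj => ?_
  rw [if_pos (by simpa [Nat.lt_succ_iff] using hj)]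
  simp [hp, mul_div_assoc]

theorem isTrapRatio_coeff_trapSeries {μ : ℝ} (hμ : 0 < μ) :
    IsTrapRatio μ fun n => coeff n (trapSeries μ) / (n : ℝ) ^ (μ - 1) := by
  have aux : ∀ (a x : ℝ), 0 < a → a ^ μ * (x / a ^ (μ - 1)) = a * x := by
    intro a x ha
    rw [Real.rpow_sub_one ha.ne']
    have : a ^ μ ≠ 0 := by positivity
    field_simp
  intro n
  have h := coeff_trapSeries_rec μ n
  have h1 : (0 : ℝ) < (n : ℝ) + 1 := by positivity
  have e0 : (n : ℝ) ^ μ * (coeff n (trapSeries μ) / (n : ℝ) ^ (μ - 1)) =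
      n * coeff n (trapSeries μ) := by
    rcases n.eq_zero_or_pos with rfl | hn
    · simp [Real.zero_rpow hμ.ne']
    · exact aux _ _ (by exact_mod_cast hn)
  have hne : ((n : ℝ) + 1) ^ (μ - 1) ≠ 0 := by positivity
  simp only [Nat.cast_add, Nat.cast_ofNat, Nat.cast_one]
  rw [e0, aux _ _ (by positivity), h, mul_assoc (2 * μ), mul_div_cancel₀ _ hne]
  ring

theorem exists_coeff_trapSeries_le {μ : ℝ} (hμ : 0 < μ) :
    ∃ A > 0, ∀ n : ℕ, coeff n (trapSeries μ) ≤ A * ((n : ℝ) + 1) ^ (μ - 1) := by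
  obtain ⟨M, hM, h⟩ := (isTrapRatio_coeff_trapSeries hμ).exists_le hμ fun n =>
    div_nonneg (coeff_trapSeries_pos hμ n).le (by positivity)
  have h0 := coeff_trapSeries_pos hμ 0
  refine ⟨coeff 0 (trapSeries μ) + M * 3 ^ |μ - 1|, by positivity, fun n => ?_⟩
  rcases n.eq_zero_or_pos with rfl | hn
  · simp only [CharP.cast_eq_zero, zero_add, Real.one_rpow, mul_one]
    have : 0 ≤ M * 3 ^ |μ - 1| := by positivity
    linarith
  · have hn0 : (0 : ℝ) < n := by exact_mod_cast hn
    have hn1 : (1 : ℝ) ≤ n := by exact_mod_cast hn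
    have h1 := (div_le_iff₀ (by positivity)).1 (h n)
    have h2 := rpow_le_three_rpow_mul_rpow (b := (n : ℝ) + 1) (μ - 1) hn0 (by positivity)
      (by linarith) (by linarith)
    have h3 := mul_le_mul_of_nonneg_left h2 hM.le
    have h4 : 0 ≤ coeff 0 (trapSeries μ) * ((n : ℝ) + 1) ^ (μ - 1) := by positivity
    linarith

theorem exists_abs_coeff_trapSeries_sub_le {μ : ℝ} (hμ : 1 ≤ μ) :
    ∃ C > 0, ∀ n : ℕ, 1 ≤ n →
      |(n : ℝ) ^ (μ - 1) - Real.Gamma μ * coeff n (trapSeries μ)| ≤ C * (n : ℝ) ^ (μ - 3) := by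
  rcases hμ.eq_or_lt with rfl | hμ
  · refine ⟨1, one_pos, fun n hn => ?_⟩
    obtain ⟨m, rfl⟩ := Nat.exists_eq_add_of_le' hn
    rw [coeff_succ_trapSeries_one, Real.Gamma_one]
    simp only [sub_self, Real.rpow_zero, mul_one, abs_zero]
    positivity
  · have hμ0 : 0 < μ := by linarith
    have hy := isTrapRatio_coeff_trapSeries hμ0
    obtain ⟨C, hC, h⟩ := hy.exists_abs_sub_two_le hμ fun n =>
      div_nonneg (coeff_trapSeries_pos hμ0 n).le (by positivity)
    have hG := Real.Gamma_pos_of_pos hμ0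
    refine ⟨Real.Gamma μ * C, by positivity, fun n hn => ?_⟩
    have hn0 : (0 : ℝ) < n := by exact_mod_cast hn
    have hp : 0 < (n : ℝ) ^ (μ - 1) := by positivity
    have h1 := abs_sub_le_of_abs_sub_two_le hC (tendsto_coeff_trapSeries_div hμ) h n hn
    have e : (n : ℝ) ^ (μ - 1) - Real.Gamma μ * coeff n (trapSeries μ) =
        -(Real.Gamma μ * (n : ℝ) ^ (μ - 1) *
          (coeff n (trapSeries μ) / (n : ℝ) ^ (μ - 1) - (Real.Gamma μ)⁻¹)) := by
      field_simp
      ring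
    have e2 : (n : ℝ) ^ (μ - 3) = (n : ℝ) ^ (μ - 1) / (n : ℝ) ^ 2 := by
      rw [show μ - 3 = μ - 1 - (2 : ℕ) by push_cast; ring, Real.rpow_sub hn0, Real.rpow_natCast]
    rw [e, abs_neg, abs_mul, abs_of_pos (by positivity), e2]
    calc _ ≤ Real.Gamma μ * (n : ℝ) ^ (μ - 1) * (C / (n : ℝ) ^ 2) := by gcongr
      _ = _ := by ring

/-- The difference between `k ^ ν` and its approximation by the coefficients of `trapSeries` decays
fast enough to be convolved without a logarithmic loss. -/
theorem exists_abs_rpow_sub_coeff_le {ν : ℝ} (hν : 0 ≤ ν) :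
    ∃ s : ℝ, s ≠ 0 ∧ s ≤ max (ν - 1) 0 ∧ ∃ R > 0, ∀ k : ℕ,
      |(k : ℝ) ^ ν - Real.Gamma (ν + 1) * coeff k (trapSeries (ν + 1))| ≤
        R * ((k : ℝ) + 1) ^ (s - 1) := by
  set r : ℕ → ℝ := fun k => (k : ℝ) ^ ν - Real.Gamma (ν + 1) * coeff k (trapSeries (ν + 1)) with hr
  by_cases h1 : ν = 1
  · subst h1
    refine ⟨-1, by norm_num, by norm_num, |r 0| + 1, by positivity, fun k => ?_⟩
    rcases k with _ | k
    · simp [hr]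
    · have : r (k + 1) = 0 := by
        simp only [hr, one_add_one_eq_two, coeff_succ_trapSeries_two, Real.Gamma_two]
        push_cast
        simp
      simp only [hr] at this
      rw [this, abs_zero]
      positivity
  · obtain ⟨C, hC, h⟩ := exists_abs_coeff_trapSeries_sub_le (μ := ν + 1) (by linarith)
    refine ⟨ν - 1, sub_ne_zero.2 h1, le_max_left _ _, |r 0| + C * 3 ^ |ν - 1 - 1|, by positivity,
      fun k => ?_⟩
    rcases k.eq_zero_or_pos with rfl | hk
    · simp only [hr, CharP.cast_eq_zero, zero_add, Real.one_rpow, mul_one]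
      have : 0 ≤ C * 3 ^ |ν - 1 - 1| := by positivity
      linarith
    · have hk0 : (0 : ℝ) < k := by exact_mod_cast hk
      have hk1 : (1 : ℝ) ≤ k := by exact_mod_cast hk
      have h2 := h k hk
      rw [add_sub_cancel_right, show ν + 1 - 3 = ν - 1 - 1 by ring] at h2
      have h3 := rpow_le_three_rpow_mul_rpow (b := (k : ℝ) + 1) (ν - 1 - 1) hk0 (by positivity)
        (by linarith) (by linarith)
      have h4 := mul_le_mul_of_nonneg_left h3 hC.le
      have h5 : 0 ≤ |r 0| * ((k : ℝ) + 1) ^ (ν - 1 - 1) := by positivity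
      linarith

theorem exists_abs_quadrature_error_le {β ν : ℝ} (hβ : 0 < β) (hν : 0 ≤ ν) :
    ∃ C > 0, ∀ n : ℕ, 1 ≤ n →
      |Real.Gamma (ν + 1) / Real.Gamma (ν + β + 1) * (n : ℝ) ^ (ν + β)
        - ∑ k ∈ range (n + 1), coeff (n - k) (trapSeries β) * (k : ℝ) ^ ν| ≤
        C * ((n : ℝ) ^ (ν + β - 2) + (n : ℝ) ^ (β - 1)) := by
  obtain ⟨A, hA, hw⟩ := exists_coeff_trapSeries_le hβ
  obtain ⟨s, hs0, hs, R, hR, hr⟩ := exists_abs_rpow_sub_coeff_le hν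
  obtain ⟨B, hB, hconv⟩ := exists_conv_rpow_le hβ hs0
  obtain ⟨D, hD, hmain⟩ := exists_abs_coeff_trapSeries_sub_le (μ := ν + β + 1) (by linarith)
  have hG1 := Real.Gamma_pos_of_pos (show 0 < ν + 1 by linarith)
  have hG2 := Real.Gamma_pos_of_pos (show 0 < ν + β + 1 by linarith)
  set G1 := Real.Gamma (ν + 1)
  set G2 := Real.Gamma (ν + β + 1)
  refine ⟨G1 / G2 * D + A * R * (B * 2), by positivity, fun n hn => ?_⟩
  have hn1 : (1 : ℝ) ≤ n := by exact_mod_cast hn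
  have hn0 : (0 : ℝ) < n := by linarith
  set P := (n : ℝ) ^ (ν + β - 2) + (n : ℝ) ^ (β - 1) with hP
  have hsplit : ∑ k ∈ range (n + 1), coeff (n - k) (trapSeries β) * (k : ℝ) ^ ν =
      G1 * coeff n (trapSeries (ν + β + 1)) +
      ∑ k ∈ range (n + 1), coeff (n - k) (trapSeries β) *
        ((k : ℝ) ^ ν - G1 * coeff k (trapSeries (ν + 1))) := by
    rw [show ν + β + 1 = (ν + 1) + β by ring, trapSeries_add, coeff_mul,
      Finset.Nat.sum_antidiagonal_eq_sum_range_succ_mk, mul_sum, ← sum_add_distrib]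
    exact sum_congr rfl fun k _ => by ring
  have h1 : |G1 / G2 * (n : ℝ) ^ (ν + β) - G1 * coeff n (trapSeries (ν + β + 1))| ≤
      G1 / G2 * D * P := by
    have h := hmain n hn
    rw [add_sub_cancel_right, show ν + β + 1 - 3 = ν + β - 2 by ring] at h
    have e : G1 / G2 * (n : ℝ) ^ (ν + β) - G1 * coeff n (trapSeries (ν + β + 1)) =
        G1 / G2 * ((n : ℝ) ^ (ν + β) - G2 * coeff n (trapSeries (ν + β + 1))) := by
      field_simp
    rw [e, abs_mul, abs_of_pos (by positivity), mul_assoc]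
    have : 0 ≤ (n : ℝ) ^ (β - 1) := by positivity
    gcongr
    exact h.trans (by gcongr; linarith)
  have h2 : |∑ k ∈ range (n + 1), coeff (n - k) (trapSeries β) *
        ((k : ℝ) ^ ν - G1 * coeff k (trapSeries (ν + 1)))| ≤ A * R * (B * 2) * P := by
    have hle : (n : ℝ) ^ (β + s - 1) ≤ P := by
      rcases le_max_iff.1 hs with h | h
      · have := Real.rpow_le_rpow_of_exponent_le hn1 (show β + s - 1 ≤ ν + β - 2 by linarith)
        have : 0 ≤ (n : ℝ) ^ (β - 1) := by positivity
        linarith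
      · have := Real.rpow_le_rpow_of_exponent_le hn1 (show β + s - 1 ≤ β - 1 by linarith)
        have : 0 ≤ (n : ℝ) ^ (ν + β - 2) := by positivity
        linarith
    have hle2 : (n : ℝ) ^ (β - 1) ≤ P := by
      have : 0 ≤ (n : ℝ) ^ (ν + β - 2) := by positivity
      linarith
    calc _ ≤ ∑ k ∈ range (n + 1), A * R *
          ((((n - k : ℕ) : ℝ) + 1) ^ (β - 1) * ((k : ℝ) + 1) ^ (s - 1)) := by
          refine (abs_sum_le_sum_abs _ _).trans (sum_le_sum fun k _ => ?_)
          rw [abs_mul, abs_of_pos (coeff_trapSeries_pos hβ _)]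
          refine (mul_le_mul (hw _) (hr k) (abs_nonneg _) (by positivity)).trans_eq (by ring)
      _ ≤ A * R * (B * ((n : ℝ) ^ (β + s - 1) + (n : ℝ) ^ (β - 1))) := by
          rw [← mul_sum]
          gcongr
          exact hconv n hn
      _ ≤ A * R * (B * (P + P)) := by gcongr
      _ = _ := by ring
  rw [hsplit, ← sub_sub, add_mul]
  exact (abs_sub _ _).trans (add_le_add h1 h2)

/-- second-order fractional trapezoidal quadrature for powers:
with `α_k = (−1)^k binom(β,k)`, `θ_k = 2^{−β} binom(β,k)` and `ω` determined by
`∑_{j=0}^k α_j ω_{k−j} = θ_k` (Taylor coefficients of `((1+z)/(2(1−z)))^β`),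
for `β > 0` and `ν ≥ 0` there is `C > 0` (depending only on `β`, `ν`) with
`|Γ(ν+1)/Γ(ν+β+1)·t_n^{ν+β} − τ^β ∑_{k=0}^n ω_{n−k}(kτ)^ν|
  ≤ C (t_n^{ν+β−2} τ² + t_n^{β−1} τ^{ν+1})` for all `τ > 0`, `n ≥ 1`, `t_n = nτ`. -/
theorem stmt_14 (β ν : ℝ) (hβ : 0 < β) (hν : 0 ≤ ν)
    (ω : ℕ → ℝ)
    (hω : ∀ k : ℕ, ∑ j ∈ Finset.range (k + 1), (-1 : ℝ) ^ j * gbinom β j * ω (k - j) =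
      2 ^ (-β) * gbinom β k) :
    ∃ C > 0, ∀ τ : ℝ, 0 < τ → ∀ n : ℕ, 1 ≤ n →
      |Real.Gamma (ν + 1) / Real.Gamma (ν + β + 1) * ((n : ℝ) * τ) ^ (ν + β)
        - τ ^ β * ∑ k ∈ Finset.range (n + 1), ω (n - k) * ((k : ℝ) * τ) ^ ν| ≤
        C * (((n : ℝ) * τ) ^ (ν + β - 2) * τ ^ 2 + ((n : ℝ) * τ) ^ (β - 1) * τ ^ (ν + 1)) := by
  obtain ⟨C, hC, h⟩ := exists_abs_quadrature_error_le hβ hν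
  refine ⟨C, hC, fun τ hτ n hn => ?_⟩
  have hn0 : (0 : ℝ) < n := by exact_mod_cast hn
  have e1 : ((n : ℝ) * τ) ^ (ν + β) = (n : ℝ) ^ (ν + β) * τ ^ (ν + β) :=
    Real.mul_rpow hn0.le hτ.le
  have e2 : τ ^ β * ∑ k ∈ range (n + 1), ω (n - k) * ((k : ℝ) * τ) ^ ν =
      τ ^ (ν + β) * ∑ k ∈ range (n + 1), coeff (n - k) (trapSeries β) * (k : ℝ) ^ ν := by
    rw [Real.rpow_add hτ, mul_sum, mul_sum]
    refine sum_congr rfl fun k _ => ?_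
    rw [eq_coeff_trapSeries hω, Real.mul_rpow k.cast_nonneg hτ.le]
    ring
  have e3 : ((n : ℝ) * τ) ^ (ν + β - 2) * τ ^ 2 = τ ^ (ν + β) * (n : ℝ) ^ (ν + β - 2) := by
    rw [Real.mul_rpow hn0.le hτ.le, mul_assoc, ← Real.rpow_natCast τ 2, ← Real.rpow_add hτ,
      mul_comm]
    norm_num
  have e4 : ((n : ℝ) * τ) ^ (β - 1) * τ ^ (ν + 1) = τ ^ (ν + β) * (n : ℝ) ^ (β - 1) := by
    rw [Real.mul_rpow hn0.le hτ.le, mul_assoc, ← Real.rpow_add hτ, mul_comm]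
    ring_nf
  rw [e1, e2, e3, e4, ← mul_add, ← mul_assoc, mul_comm _ (τ ^ (ν + β)), ← mul_sub, abs_mul,
    abs_of_pos (by positivity), mul_left_comm]
  gcongr
  exact h n hn
end

section
/- (Stability region of the generalized Newton–Gregory scheme.) Let 1 < β < 2 and let s be a real number with 2^{β}/(1−β) < s < 0. Then for every complex number z with |z| ≤ 1, one has (1−z)^{β} − s (1 − β/2 + (β/2) z) ≠ 0; that is, the interval (2^{β}/(1−β), 0) is contained in the region ℂ \ { (1−z)^{β} / (1 − β/2 + (β/2)z) : |z| ≤ 1 }. -/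
/-- Bernoulli's inequality, in the form that makes `x ^ β / (β * x / 2 - 1)` minimal at `x = 2`. -/
lemma two_rpow_mul_le_rpow {β x : ℝ} (hβ1 : 1 < β) (hβ2 : β < 2) (hx0 : 0 < x) (hx2 : x ≤ 2) :
    (2 : ℝ) ^ β * (β * x / 2 - 1) ≤ (β - 1) * x ^ β := by
  have hb := one_add_mul_self_le_rpow_one_add (s := x / 2 - 1) (by linarith) hβ1.le
  rw [show 1 + (x / 2 - 1) = x / 2 by ring] at hb
  have hx : x ^ β = 2 ^ β * (x / 2) ^ β := by
    rw [← Real.mul_rpow (by norm_num) (by positivity), mul_div_cancel₀ x two_ne_zero]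
  have hu : β * x / 2 - 1 ≤ (β - 1) * (x / 2) ^ β := by
    nlinarith [mul_le_mul_of_nonneg_left hb (sub_nonneg.2 hβ1.le),
      mul_nonneg (mul_nonneg (by linarith : 0 ≤ β) (by linarith : 0 ≤ 2 - β))
        (by linarith : 0 ≤ 1 - x / 2)]
  rw [hx]
  nlinarith [mul_le_mul_of_nonneg_left hu (by positivity : (0 : ℝ) ≤ 2 ^ β)]

lemma mul_sin_lt_sin_mul {β φ r : ℝ} (hβ1 : 1 < β) (hβ2 : β < 2) (hφ0 : 0 < φ)
    (hφ : φ < Real.pi / 2) (hr : r ≤ 2 * Real.cos φ) :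
    β / 2 * r * Real.sin (β * φ - φ) < Real.sin (β * φ) := by
  have hγ0 : 0 < β * φ - φ := by nlinarith
  have hγ1 : β * φ - φ < φ := by nlinarith
  have hs : 0 < Real.sin (β * φ - φ) := Real.sin_pos_of_pos_of_lt_pi hγ0 (by linarith)
  have hc : 0 < Real.cos φ := Real.cos_pos_of_mem_Ioo ⟨by linarith, hφ⟩
  have hd : 0 < Real.sin (φ - (β * φ - φ)) :=
    Real.sin_pos_of_pos_of_lt_pi (by linarith) (by linarith)
  have ha : Real.sin (β * φ) = Real.sin (β * φ - φ + φ) := by ring_nf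
  rw [Real.sin_sub] at hd
  rw [ha, Real.sin_add]
  nlinarith [mul_le_mul_of_nonneg_left hr (by positivity : 0 ≤ β * Real.sin (β * φ - φ)),
    mul_pos (mul_pos hs hc) (by linarith : 0 < 2 - β)]

lemma cpow_ne_mul_one_sub_of_norm_sub_one_le {β s : ℝ} (hβ1 : 1 < β) (hβ2 : β < 2)
    (hs1 : (2 : ℝ) ^ β / (1 - β) < s) (hs2 : s < 0) {w : ℂ} (hw : ‖w - 1‖ ≤ 1) :
    w ^ (β : ℂ) ≠ s * (1 - β / 2 * w) := by
  intro h
  rcases eq_or_ne w 0 with rfl | hw0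
  · rw [Complex.zero_cpow (by exact_mod_cast (by linarith : β ≠ 0))] at h
    simp only [mul_zero, sub_zero, mul_one] at h
    exact hs2.ne (by exact_mod_cast h.symm)
  have hnorm : 0 < ‖w‖ := norm_pos_iff.2 hw0
  have hre : Real.cos w.arg * ‖w‖ = w.re := by rw [mul_comm, Complex.norm_mul_cos_arg]
  have him : Real.sin w.arg * ‖w‖ = w.im := by rw [mul_comm, Complex.norm_mul_sin_arg]
  have hsq : ‖w‖ ^ 2 ≤ 2 * w.re := by
    have h1 : ‖w - 1‖ ^ 2 ≤ 1 := pow_le_one₀ (norm_nonneg _) hw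
    rw [Complex.sq_norm, Complex.normSq_apply] at h1 ⊢
    simp at h1
    nlinarith
  have hr : ‖w‖ ≤ 2 * Real.cos w.arg := by nlinarith
  have hre0 : 0 < w.re := by nlinarith
  have harg : |w.arg| < Real.pi / 2 := Complex.abs_arg_lt_pi_div_two_iff.2 (Or.inl hre0)
  have hR := congrArg Complex.re h
  have hI := congrArg Complex.im h
  rw [Complex.cpow_ofReal_re, mul_comm w.arg] at hR
  rw [Complex.cpow_ofReal_im, mul_comm w.arg] at hI
  have hdiv (u : ℂ) : (β : ℂ) / 2 * u = ((β / 2 : ℝ) : ℂ) * u := by push_cast; rfl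
  rw [hdiv] at hR hI
  simp only [Complex.re_ofReal_mul, Complex.im_ofReal_mul, Complex.sub_re, Complex.sub_im,
    Complex.one_re, Complex.one_im, ← hre, ← him] at hR hI
  rcases eq_or_ne w.arg 0 with h0 | h0
  · simp only [h0, mul_zero, Real.cos_zero, mul_one, one_mul] at hR hr
    have hb := two_rpow_mul_le_rpow hβ1 hβ2 hnorm hr
    rw [div_lt_iff_of_neg (by linarith)] at hs1
    have hp : 0 < ‖w‖ ^ β := by positivity
    have hq : 0 < β * ‖w‖ / 2 - 1 := by nlinarith
    nlinarith [mul_lt_mul_of_pos_right hs1 hq]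
  · have key : β / 2 * ‖w‖ * Real.sin (β * w.arg - w.arg) = Real.sin (β * w.arg) := by
      rw [Real.sin_sub]
      apply mul_left_cancel₀ hs2.ne
      linear_combination Real.sin (β * w.arg) * hR - Real.cos (β * w.arg) * hI
    rcases lt_or_gt_of_ne h0 with hneg | hpos
    · have hlt := mul_sin_lt_sin_mul (φ := -w.arg) (r := ‖w‖) hβ1 hβ2 (by linarith)
        (by rwa [abs_of_neg hneg] at harg) (by rwa [Real.cos_neg])
      rw [show β * -w.arg - -w.arg = -(β * w.arg - w.arg) by ring, mul_neg β,
        Real.sin_neg, Real.sin_neg] at hlt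
      linarith
    · have hlt := mul_sin_lt_sin_mul hβ1 hβ2 hpos (by rwa [abs_of_pos hpos] at harg) hr
      linarith


/-- stability region of the generalized Newton–Gregory scheme:
for `1 < β < 2` and real `s` with `2^β/(1−β) < s < 0`, for every complex `z` with `|z| ≤ 1`
one has `(1−z)^β − s(1 − β/2 + (β/2)z) ≠ 0` (principal branch powers, `0^β = 0`);
i.e. the interval `(2^β/(1−β), 0)` lies in
`ℂ \ {(1−z)^β / (1 − β/2 + (β/2)z) : |z| ≤ 1}`. -/
theorem stmt_15 (β s : ℝ) (hβ1 : 1 < β) (hβ2 : β < 2)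
    (hs1 : (2 : ℝ) ^ β / (1 - β) < s) (hs2 : s < 0) :
    ∀ z : ℂ, ‖z‖ ≤ 1 →
      (1 - z) ^ (β : ℂ) - (s : ℂ) * (1 - (β : ℂ) / 2 + ((β : ℂ) / 2) * z) ≠ 0 := by
  intro z hz h
  apply cpow_ne_mul_one_sub_of_norm_sub_one_le hβ1 hβ2 hs1 hs2 (w := 1 - z) (by simpa using hz)
  linear_combination h
end

section
/- (Stability region of the modified Newton–Gregory scheme.) Let 1 < β < 2 and let s be a real number with s < 0. Then for every complex number z with |z| ≤ 1, one has (1−z)^{β} − s (1 − β/4 + (β/4) z²) ≠ 0; that is, the negative real axis is contained in the region ℂ \ { (1−z)^{β} / (1 − β/4 + (β/4)z²) : |z| ≤ 1 }. -/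
/-- The function `x ↦ sin x / x` compared at two points, in cross-multiplied form. -/
lemma mul_sin_lt_mul_sin_of_lt {x y : ℝ} (hx : 0 < x) (hxy : x < y) (hxπ : x < Real.pi)
    (hy : y ≤ 2 * Real.pi) : x * Real.sin y < y * Real.sin x := by
  have hy0 : 0 < y := hx.trans hxy
  rcases le_or_gt y Real.pi with hyπ | hyπ
  · have hlt : 0 < 1 - x / y := by rw [sub_pos, div_lt_one hy0]; exact hxy
    have h := strictConcaveOn_sin_Icc.2 ⟨hy0.le, hyπ⟩ ⟨le_rfl, Real.pi_pos.le⟩ hy0.ne'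
      (div_pos hx hy0) hlt (by ring)
    simp only [smul_eq_mul, Real.sin_zero, mul_zero, add_zero] at h
    rw [div_mul_cancel₀ _ hy0.ne', div_mul_eq_mul_div, div_lt_iff₀ hy0] at h
    linarith
  · have h1 : 0 < Real.sin x := Real.sin_pos_of_pos_of_lt_pi hx hxπ
    have h2 : Real.sin y ≤ 0 := by
      rw [← Real.sin_sub_two_pi]
      exact Real.sin_nonpos_of_nonpos_of_neg_pi_le (by linarith) (by linarith)
    nlinarith [mul_pos hy0 h1, mul_nonneg hx.le (neg_nonneg.2 h2)]

/-- With `w = r * exp (i * θ)` in the upper half of the disc `|1 - w| ≤ 1`, the imaginary part of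
`exp (-i * β * θ) * (1 - (β / 2) * w + (β / 4) * w ^ 2)` is negative. -/
lemma rotated_im_neg {β r θ : ℝ} (hβ1 : 1 < β) (hβ2 : β < 2) (hr : 0 ≤ r) (hθ : 0 < θ)
    (hθ2 : θ < Real.pi / 2) (hrθ : r ≤ 2 * Real.cos θ) :
    -Real.sin (β * θ) + β / 2 * r * Real.sin (β * θ - θ)
      + β / 4 * r ^ 2 * Real.sin (2 * θ - β * θ) < 0 := by
  have h1 : 0 ≤ Real.sin (β * θ - θ) :=
    Real.sin_nonneg_of_nonneg_of_le_pi (by nlinarith) (by nlinarith)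
  have h2 : 0 ≤ Real.sin (2 * θ - β * θ) :=
    Real.sin_nonneg_of_nonneg_of_le_pi (by nlinarith) (by nlinarith)
  have h3 := mul_sin_lt_mul_sin_of_lt (x := β * θ) (y := 4 * θ - β * θ) (by positivity)
    (by nlinarith) (by nlinarith) (by nlinarith)
  have h4 : β * Real.sin (4 * θ - β * θ) < (4 - β) * Real.sin (β * θ) := by
    refine lt_of_mul_lt_mul_left ?_ hθ.le
    linarith
  have h5 : β / 2 * r * Real.sin (β * θ - θ)
      ≤ β / 2 * (2 * Real.cos θ) * Real.sin (β * θ - θ) := by gcongr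
  have h6 : β / 4 * r ^ 2 * Real.sin (2 * θ - β * θ)
      ≤ β / 4 * (2 * Real.cos θ) ^ 2 * Real.sin (2 * θ - β * θ) := by gcongr
  have h7 : -Real.sin (β * θ) + β / 2 * (2 * Real.cos θ) * Real.sin (β * θ - θ)
      + β / 4 * (2 * Real.cos θ) ^ 2 * Real.sin (2 * θ - β * θ)
      = (β * Real.sin (4 * θ - β * θ) - (4 - β) * Real.sin (β * θ)) / 4 := by
    rw [show 4 * θ - β * θ = 2 * (2 * θ) - β * θ by ring]
    simp only [Real.sin_sub, Real.cos_two_mul, Real.sin_two_mul]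
    ring_nf
  linarith

/-- stability region of the modified Newton–Gregory scheme:
for `1 < β < 2` and real `s < 0`, for every complex `z` with `|z| ≤ 1` one has
`(1−z)^β − s(1 − β/4 + (β/4)z²) ≠ 0` (principal branch powers, `0^β = 0`);
i.e. the negative real axis lies in
`ℂ \ {(1−z)^β / (1 − β/4 + (β/4)z²) : |z| ≤ 1}`. -/
theorem stmt_16 (β s : ℝ) (hβ1 : 1 < β) (hβ2 : β < 2) (hs : s < 0) :
    ∀ z : ℂ, ‖z‖ ≤ 1 →
      (1 - z) ^ (β : ℂ) - (s : ℂ) * (1 - (β : ℂ) / 4 + ((β : ℂ) / 4) * z ^ 2) ≠ 0 := by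
  intro z hz h
  obtain ⟨w, rfl⟩ : ∃ w, z = 1 - w := ⟨1 - z, by ring⟩
  rw [sub_sub_cancel] at h
  rcases eq_or_ne w 0 with rfl | hw
  · rw [Complex.zero_cpow (by exact_mod_cast (by linarith : β ≠ 0))] at h
    apply hs.ne
    have : (s : ℂ) = 0 := by linear_combination -h
    exact_mod_cast this
  obtain ⟨r, hr⟩ : ∃ r, r = ‖w‖ := ⟨_, rfl⟩
  obtain ⟨θ, hθ⟩ : ∃ θ, θ = w.arg := ⟨_, rfl⟩
  have hr0 : 0 < r := hr ▸ norm_pos_iff.2 hw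
  have hre : w.re = r * Real.cos θ := by rw [hr, hθ, Complex.norm_mul_cos_arg]
  have him : w.im = r * Real.sin θ := by rw [hr, hθ, Complex.norm_mul_sin_arg]
  have hsc := Real.sin_sq_add_cos_sq θ
  have hrθ : r ≤ 2 * Real.cos θ := by
    have h1 : Complex.normSq (1 - w) ≤ 1 := by
      rw [Complex.normSq_eq_norm_sq]
      exact pow_le_one₀ (norm_nonneg _) hz
    simp only [Complex.normSq_apply, Complex.sub_re, Complex.sub_im, Complex.one_re,
      Complex.one_im, hre, him] at h1
    refine le_of_mul_le_mul_left ?_ hr0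
    nlinarith
  have hθabs : |θ| < Real.pi / 2 := by
    rw [hθ, Complex.abs_arg_lt_pi_div_two_iff]
    left
    rw [hre]
    exact mul_pos hr0 (by linarith)
  have hrβ : 0 < r ^ β := Real.rpow_pos_of_pos hr0 β
  have hRe : r ^ β * Real.cos (β * θ)
      = s * (1 - β / 2 * r * Real.cos θ + β / 4 * r ^ 2 * Real.cos (2 * θ)) := by
    have := congrArg Complex.re (sub_eq_zero.1 h)
    rw [Complex.cpow_ofReal_re, ← hr, ← hθ, mul_comm θ] at this
    rw [this, Real.cos_two_mul']
    simp [pow_two, hre, him, -Complex.ofReal_cos, -Complex.ofReal_sin, -mul_eq_mul_left_iff]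
    ring
  have hIm : r ^ β * Real.sin (β * θ)
      = s * (-(β / 2 * r * Real.sin θ) + β / 4 * r ^ 2 * Real.sin (2 * θ)) := by
    have := congrArg Complex.im (sub_eq_zero.1 h)
    rw [Complex.cpow_ofReal_im, ← hr, ← hθ, mul_comm θ] at this
    rw [this, Real.sin_two_mul]
    simp [pow_two, hre, him, -Complex.ofReal_cos, -Complex.ofReal_sin, -mul_eq_mul_left_iff]
    ring
  have hzero : -Real.sin (β * θ) + β / 2 * r * Real.sin (β * θ - θ)
      + β / 4 * r ^ 2 * Real.sin (2 * θ - β * θ) = 0 := by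
    rw [Real.sin_sub, Real.sin_sub]
    refine (mul_eq_zero.1 ?_).resolve_left hs.ne
    linear_combination Real.sin (β * θ) * hRe - Real.cos (β * θ) * hIm
  rcases lt_trichotomy θ 0 with hneg | hθ0 | hpos
  · have hlt := rotated_im_neg hβ1 hβ2 hr0.le (neg_pos.2 hneg) (by rwa [← abs_of_neg hneg])
      (by rwa [Real.cos_neg])
    rw [show β * -θ - -θ = -(β * θ - θ) by ring, show 2 * -θ - β * -θ = -(2 * θ - β * θ) by ring,
      mul_neg β, Real.sin_neg, Real.sin_neg, Real.sin_neg] at hlt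
    linarith
  · rw [hθ0] at hRe
    simp only [mul_zero, Real.cos_zero, mul_one] at hRe
    have hD : 0 < 1 - β / 2 * r + β / 4 * r ^ 2 := by
      nlinarith [mul_nonneg (by linarith : 0 ≤ β) (sq_nonneg (1 - r))]
    linarith [mul_pos_of_neg_of_neg hs (neg_neg_of_pos hD)]
  · exact (rotated_im_neg hβ1 hβ2 hr0.le hpos (by rwa [← abs_of_pos hpos]) hrθ).ne hzero
end

section
/- (Equivalence of the Caputo fractional ODE and a Volterra integral equation.) Let 1 < β < 2, T > 0, μ ∈ ℝ, let g : [0,T] → ℝ be continuous, and let y : [0,T] → ℝ be twice continuously differentiable. Suppose that for every t ∈ [0,T], (1/Γ(2−β)) ∫_0^t (t−s)^{1−β} y''(s) ds = μ y(t) + g(t). Then for every t ∈ [0,T], y(t) − y(0) − y'(0) t = (μ/Γ(β)) ∫_0^t (t−s)^{β−1} y(s) ds + (1/Γ(β)) ∫_0^t (t−s)^{β−1} g(s) ds. -/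
theorem integral_sub_rpow_mul_rpow {β r t : ℝ} (hβ1 : 0 < β) (hβ2 : β < 2) (hrt : r ≤ t) :
    ∫ s in r..t, (t - s) ^ (β - 1) * (s - r) ^ (1 - β) =
      Real.Gamma β * Real.Gamma (2 - β) * (t - r) := by
  rcases hrt.eq_or_lt with rfl | h
  · simp
  have ha : 0 < t - r := sub_pos.2 h
  have key := Complex.betaIntegral_scaled ((2 - β : ℝ) : ℂ) (β : ℂ) ha
  rw [Complex.betaIntegral_eq_Gamma_mul_div _ _ (by simp; linarith) (by simpa using hβ1)] at key
  have e : ((2 - β : ℝ) : ℂ) + β = 2 := by push_cast; ring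
  rw [e, Complex.Gamma_ofReal, Complex.Gamma_ofReal, Complex.Gamma_ofNat_eq_factorial] at key
  have h2 : ∫ s in r..t, (t - s) ^ (β - 1) * (s - r) ^ (1 - β) =
      ∫ x in (0 : ℝ)..(t - r), x ^ (1 - β) * (t - r - x) ^ (β - 1) := by
    have := intervalIntegral.integral_comp_sub_right (a := r) (b := t)
      (fun x => x ^ (1 - β) * (t - r - x) ^ (β - 1)) r
    rw [sub_self] at this
    rw [← this]
    congr 1; ext s
    rw [mul_comm]; ring_nf
  rw [h2]
  have h3 : ((∫ x in (0 : ℝ)..(t - r), x ^ (1 - β) * (t - r - x) ^ (β - 1) : ℝ) : ℂ) =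
      ∫ x in (0 : ℝ)..(t - r), (x : ℂ) ^ (((2 - β : ℝ) : ℂ) - 1) *
        (((t - r : ℝ) : ℂ) - x) ^ ((β : ℂ) - 1) := by
    rw [← intervalIntegral.integral_ofReal]
    refine intervalIntegral.integral_congr fun x hx => ?_
    rw [Set.uIcc_of_le ha.le] at hx
    have e1 : ((2 - β : ℝ) : ℂ) - 1 = ((1 - β : ℝ) : ℂ) := by push_cast; ring
    simp only [e1, Complex.ofReal_mul, Complex.ofReal_cpow hx.1,
      Complex.ofReal_cpow (sub_nonneg.2 hx.2)]
    push_cast; rfl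
  have h4 : (2 : ℂ) - 1 = 1 := by norm_num
  rw [key, h4, Complex.cpow_one] at h3
  apply Complex.ofReal_injective
  rw [h3]
  push_cast
  simp
  ring

theorem integral_sub_mul_iteratedDeriv_two {y : ℝ → ℝ} (hy : ContDiff ℝ 2 y) (a t : ℝ) :
    ∫ r in a..t, (t - r) * iteratedDeriv 2 y r = y t - y a - deriv y a * (t - a) := by
  have hd : ContDiff ℝ 1 (deriv y) := (contDiff_succ_iff_deriv (n := 1).1 hy).2.2
  have hc : Continuous (iteratedDeriv 2 y) := hy.continuous_iteratedDeriv' 2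
  have h1 (r : ℝ) : HasDerivAt y (deriv y r) r := (hy.differentiable (by norm_num) r).hasDerivAt
  have h2 (r : ℝ) : HasDerivAt (deriv y) (iteratedDeriv 2 y r) r := by
    rw [iteratedDeriv_succ, iteratedDeriv_one]
    exact (hd.differentiable (by norm_num) r).hasDerivAt
  have h3 (r : ℝ) : HasDerivAt (fun r => (t - r) * deriv y r + y r)
      ((t - r) * iteratedDeriv 2 y r) r := by
    refine ((((hasDerivAt_id r).const_sub t).mul (h2 r)).add (h1 r)).congr_deriv ?_
    simp
  rw [intervalIntegral.integral_eq_sub_of_hasDerivAt (fun r _ => h3 r)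
    (by apply Continuous.intervalIntegrable; fun_prop)]
  ring

section

open MeasureTheory

theorem integral_sub_rpow_mul_integral_sub_rpow {β t : ℝ} (hβ1 : 1 ≤ β) (hβ2 : β < 2)
    (ht : 0 ≤ t) {w : ℝ → ℝ} (hw : IntervalIntegrable w volume 0 t) :
    ∫ s in (0 : ℝ)..t, (t - s) ^ (β - 1) * ∫ r in (0 : ℝ)..s, (s - r) ^ (1 - β) * w r =
      Real.Gamma β * Real.Gamma (2 - β) * ∫ r in (0 : ℝ)..t, (t - r) * w r := by
  set a : ℝ → ℝ := (Set.Ioc 0 t).indicator fun s => (t - s) ^ (β - 1) with ha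
  set f : ℝ → ℝ := (Set.Ioc 0 t).indicator w with hf
  set k : ℝ → ℝ := (Set.Icc 0 t).indicator fun u => u ^ (1 - β) with hk
  have hfi : Integrable f := (integrable_indicator_iff measurableSet_Ioc).2
    ((intervalIntegrable_iff_integrableOn_Ioc_of_le ht).1 hw)
  have hki : Integrable k := (integrable_indicator_iff measurableSet_Icc).2
    ((intervalIntegrable_iff_integrableOn_Icc_of_le ht).1
      (intervalIntegral.intervalIntegrable_rpow' (by linarith)))
  have ham : Measurable a := Measurable.indicator (by fun_prop) measurableSet_Ioc
  have hab (s : ℝ) : ‖a s‖ ≤ t ^ (β - 1) := by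
    by_cases hs : s ∈ Set.Ioc 0 t
    · rw [ha, Set.indicator_of_mem hs, Real.norm_of_nonneg
        (Real.rpow_nonneg (sub_nonneg.2 hs.2) _)]
      exact Real.rpow_le_rpow (sub_nonneg.2 hs.2) (by linarith [hs.1]) (by linarith)
    · rw [ha, Set.indicator_of_notMem hs, norm_zero]
      positivity
  have hint : Integrable (Function.uncurry fun s r => a s * (f r * k (s - r)))
      (volume.prod volume) :=
    (hfi.convolution_integrand (ContinuousLinearMap.mul ℝ ℝ) hki).bdd_mul
      (ham.comp measurable_fst).aestronglyMeasurable (.of_forall fun p => hab p.1)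
  have hswap := integral_integral_swap hint
  have hl (s : ℝ) : ∫ r, a s * (f r * k (s - r)) = (Set.Ioc 0 t).indicator
      (fun s => (t - s) ^ (β - 1) * ∫ r in (0 : ℝ)..s, (s - r) ^ (1 - β) * w r) s := by
    by_cases hs : s ∈ Set.Ioc 0 t
    · rw [integral_const_mul, Set.indicator_of_mem hs, ha, Set.indicator_of_mem hs,
        intervalIntegral.integral_of_le hs.1.le, ← integral_indicator measurableSet_Ioc]
      congr 2; ext r
      simp only [hf, hk, Set.indicator_apply, Set.mem_Ioc, Set.mem_Icc] at hs ⊢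
      split_ifs <;> grind
    · simp [ha, hs]
  have hr (r : ℝ) : ∫ s, a s * (f r * k (s - r)) = (Set.Ioc 0 t).indicator
      (fun r => Real.Gamma β * Real.Gamma (2 - β) * ((t - r) * w r)) r := by
    by_cases hs : r ∈ Set.Ioc 0 t
    · rw [Set.indicator_of_mem hs, ← mul_assoc,
        ← integral_sub_rpow_mul_rpow (by linarith) hβ2 hs.2,
        intervalIntegral.integral_of_le hs.2, ← integral_Icc_eq_integral_Ioc,
        ← integral_indicator measurableSet_Icc, ← integral_mul_const]
      congr 1; ext s
      simp only [ha, hf, hk, Set.indicator_apply, Set.mem_Ioc, Set.mem_Icc] at hs ⊢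
      split_ifs <;> grind
    · simp [hf, hs]
  simp only [hl, hr, integral_indicator measurableSet_Ioc] at hswap
  rw [intervalIntegral.integral_of_le ht, hswap, integral_const_mul,
    intervalIntegral.integral_of_le ht]

end

/-- equivalence of the Caputo fractional ODE and a Volterra integral equation:
if `1 < β < 2`, `g` is continuous on `[0,T]`, `y` is twice continuously differentiable and
`(1/Γ(2−β)) ∫_0^t (t−s)^{1−β} y''(s) ds = μ y(t) + g(t)` on `[0,T]`, then
`y(t) − y(0) − y'(0)t = (μ/Γ(β)) ∫_0^t (t−s)^{β−1} y(s) ds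
  + (1/Γ(β)) ∫_0^t (t−s)^{β−1} g(s) ds` on `[0,T]`. -/
theorem stmt_17 (β T μ : ℝ) (hβ1 : 1 < β) (hβ2 : β < 2) (hT : 0 < T)
    (g y : ℝ → ℝ) (hg : ContinuousOn g (Set.Icc 0 T)) (hy : ContDiff ℝ 2 y)
    (heq : ∀ t ∈ Set.Icc (0 : ℝ) T,
      (1 / Real.Gamma (2 - β)) * ∫ s in (0 : ℝ)..t, (t - s) ^ (1 - β) * iteratedDeriv 2 y s =
        μ * y t + g t) :
    ∀ t ∈ Set.Icc (0 : ℝ) T,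
      y t - y 0 - deriv y 0 * t =
        (μ / Real.Gamma β) * (∫ s in (0 : ℝ)..t, (t - s) ^ (β - 1) * y s)
          + (1 / Real.Gamma β) * ∫ s in (0 : ℝ)..t, (t - s) ^ (β - 1) * g s := by
  intro t ht
  have hΓ1 : Real.Gamma β ≠ 0 := (Real.Gamma_pos_of_pos (by linarith)).ne'
  have hΓ2 : Real.Gamma (2 - β) ≠ 0 := (Real.Gamma_pos_of_pos (by linarith)).ne'
  have hp : Continuous fun s : ℝ => (t - s) ^ (β - 1) :=
    (continuous_const.sub continuous_id).rpow_const fun _ => Or.inr (by linarith)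
  have hyi : IntervalIntegrable (fun s => (t - s) ^ (β - 1) * y s) MeasureTheory.volume 0 t :=
    (hp.mul hy.continuous).intervalIntegrable _ _
  have hgi : IntervalIntegrable (fun s => (t - s) ^ (β - 1) * g s) MeasureTheory.volume 0 t := by
    refine (hp.continuousOn.mul (hg.mono ?_)).intervalIntegrable
    rw [Set.uIcc_of_le ht.1]
    exact Set.Icc_subset_Icc_right ht.2
  have hsum : μ * (∫ s in (0 : ℝ)..t, (t - s) ^ (β - 1) * y s)
      + ∫ s in (0 : ℝ)..t, (t - s) ^ (β - 1) * g s =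
      1 / Real.Gamma (2 - β) * ∫ s in (0 : ℝ)..t, (t - s) ^ (β - 1) *
        ∫ r in (0 : ℝ)..s, (s - r) ^ (1 - β) * iteratedDeriv 2 y r := by
    rw [← intervalIntegral.integral_const_mul, ← intervalIntegral.integral_const_mul,
      ← intervalIntegral.integral_add (hyi.const_mul μ) hgi]
    refine intervalIntegral.integral_congr fun s hs => ?_
    rw [Set.uIcc_of_le ht.1] at hs
    linear_combination -(t - s) ^ (β - 1) * heq s ⟨hs.1, hs.2.trans ht.2⟩
  rw [integral_sub_rpow_mul_integral_sub_rpow hβ1.le hβ2 ht.1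
    ((hy.continuous_iteratedDeriv' 2).intervalIntegrable _ _),
    integral_sub_mul_iteratedDeriv_two hy] at hsum
  field_simp at hsum ⊢
  linarith
end
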